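/- For all n ≥ 0 and all k ≥ 0, the number of Jacobi permutations π of [n] with exactly k ascents equals the number of André permutations of [n] with exactly k descents. -/

import Mathlib

/-- The length of `ρ_π(π_k)`: the maximal consecutive subword of `π` immediately to the
right of position `k`, all of whose letters are larger than `π_k`.  Letters of a
permutation of `[n] = {1,…,n}` are modelled by `(π i : ℕ) + 1` for `π : Equiv.Perm (Fin n)`. -/
noncomputable def rhoLen {n : ℕ} (π : Equiv.Perm (Fin n)) (k : Fin n) : ℕ :=
  Nat.card {j : Fin n // k < j ∧ ∀ i : Fin n, k < i → i ≤ j → π k < π i}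

/-- A permutation is Jacobi if `ρ_π(π_k)` has even length for every position `k`. -/
def IsJacobi {n : ℕ} (π : Equiv.Perm (Fin n)) : Prop :=
  ∀ k : Fin n, Even (rhoLen π k)

/-- The number of ascents of `π`. -/
noncomputable def ascCount {n : ℕ} (π : Equiv.Perm (Fin n)) : ℕ :=
  Nat.card {k : Fin n // ∃ h : (k : ℕ) + 1 < n, π k < π ⟨(k : ℕ) + 1, h⟩}

/-- The number of descents of `π`. -/
noncomputable def descCount {n : ℕ} (π : Equiv.Perm (Fin n)) : ℕ :=
  Nat.card {k : Fin n // ∃ h : (k : ℕ) + 1 < n, π ⟨(k : ℕ) + 1, h⟩ < π k}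

/-- The word (list of 1-based letters) of a permutation of `[n]`. -/
def toWord {n : ℕ} (π : Equiv.Perm (Fin n)) : List ℕ :=
  List.ofFn fun i : Fin n => (π i : ℕ) + 1

/-- André permutations (of the first kind), as words with distinct letters:
the empty word is André; and a word `π = α ++ [y] ++ β` where `y` is strictly smaller
than all other letters is André whenever `α` and `β` are André and either `α ++ β` is
empty or the largest letter of `α ++ β` is a letter of `β`. -/
inductive IsAndre : List ℕ → Prop
  | nil : IsAndre []
  | node (α β : List ℕ) (y : ℕ) (hmin : ∀ x ∈ α ++ β, y < x)
      (hα : IsAndre α) (hβ : IsAndre β)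
      (hmax : α ++ β = [] ∨ ∃ z ∈ β, ∀ x ∈ α ++ β, x ≤ z) :
      IsAndre (α ++ y :: β)

lemma ps_leibniz {R : Type*} [CommRing R] (f g : PowerSeries R) :
    PowerSeries.derivative R (f * g)
      = f * PowerSeries.derivative R g + g * PowerSeries.derivative R f := by
  rw [Derivation.leibniz]; simp only [smul_eq_mul]

section EGF
open Polynomial

/-- Exponential generating function. -/
noncomputable def egf (u : ℕ → ℚ[X]) : PowerSeries ℚ[X] :=
  PowerSeries.mk fun n => C ((n.factorial : ℚ)⁻¹) * u n

/-- Binomial convolution. -/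
noncomputable def bconv (u v : ℕ → ℚ[X]) (n : ℕ) : ℚ[X] :=
  ∑ i ∈ Finset.range (n + 1), n.choose i • (u i * v (n - i))

lemma egf_mul (u v : ℕ → ℚ[X]) : egf u * egf v = egf (bconv u v) := by
  ext1 n
  simp only [egf, PowerSeries.coeff_mul, PowerSeries.coeff_mk, bconv]
  rw [Finset.Nat.sum_antidiagonal_eq_sum_range_succ_mk, Finset.mul_sum]
  refine Finset.sum_congr rfl fun i hi => ?_
  have hi' : i ≤ n := by simpa [Nat.lt_succ_iff] using hi
  have h : ((n.factorial : ℚ)⁻¹) * (n.choose i : ℚ)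
      = (i.factorial : ℚ)⁻¹ * ((n - i).factorial : ℚ)⁻¹ := by
    rw [Nat.cast_choose ℚ hi']
    have := Nat.factorial_ne_zero n
    have := Nat.factorial_ne_zero i
    have := Nat.factorial_ne_zero (n - i)
    field_simp
  rw [nsmul_eq_mul]
  have h2 : ((n.choose i : ℕ) : ℚ[X]) = C (n.choose i : ℚ) := by simp
  rw [h2]
  calc _ = C ((i.factorial : ℚ)⁻¹ * ((n - i).factorial : ℚ)⁻¹) * (u i * v (n - i)) := by
        rw [C_mul]; ring
    _ = _ := by rw [← h, C_mul]; ring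

lemma egf_deriv (u : ℕ → ℚ[X]) :
    PowerSeries.derivative ℚ[X] (egf u) = egf fun n => u (n + 1) := by
  ext1 n
  simp only [egf, PowerSeries.coeff_derivative, PowerSeries.coeff_mk]
  have h : ((n + 1).factorial : ℚ)⁻¹ * ((n : ℚ) + 1) = (n.factorial : ℚ)⁻¹ := by
    rw [Nat.factorial_succ]
    have := Nat.factorial_ne_zero n
    push_cast
    field_simp
  have h2 : ((n : ℚ[X]) + 1) = C ((n : ℚ) + 1) := by simp
  rw [h2, ← h, C_mul]; ring

lemma egf_inj {u v : ℕ → ℚ[X]} (h : egf u = egf v) : u = v := by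
  funext n
  have := congrArg (PowerSeries.coeff n) h
  simp only [egf, PowerSeries.coeff_mk] at this
  refine mul_left_cancel₀ ?_ this
  simp [Nat.factorial_ne_zero]

lemma egf_add (u v : ℕ → ℚ[X]) : egf u + egf v = egf (u + v) := by
  ext1 n
  simp [egf, mul_add]

lemma egf_smul (c : ℚ[X]) (u : ℕ → ℚ[X]) :
    PowerSeries.C c * egf u = egf (fun n => c * u n) := by
  ext1 n
  simp only [egf, PowerSeries.coeff_C_mul, PowerSeries.coeff_mk]; ring

/-- The weight of a factor. -/
noncomputable def wt (u : ℕ → ℚ[X]) (m : ℕ) : ℚ[X] := if m = 0 then 1 else X * u m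

lemma jacobi_second_order (j : ℕ → ℚ[X])
    (hj : ∀ n, j (n + 1) = bconv j (fun m => if Even m then wt j m else 0) n) :
    ∀ n, j (n + 2) = bconv (wt j) (fun m => j (m + 1)) n := by
  set e : ℕ → ℚ[X] := fun m => if Even m then wt j m else 0 with he
  set jo : ℕ → ℚ[X] := fun m => if Even m then 0 else j m with hjo
  have hJ : PowerSeries.derivative ℚ[X] (egf j) = egf j * egf e := by
    rw [egf_deriv, egf_mul]; congr 1; funext n; exact hj n
  have hE : PowerSeries.derivative ℚ[X] (egf e) = PowerSeries.C X * (egf jo * egf e) := by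
    rw [egf_deriv, egf_mul, egf_smul]; congr 1; funext n
    simp only [he, wt, hjo]
    by_cases hn : Even (n + 1)
    · rw [if_pos hn, if_neg (by omega), hj n]
      congr 1
      refine Finset.sum_congr rfl fun i hi => ?_
      have hi' : i ≤ n := by simpa [Nat.lt_succ_iff] using hi
      by_cases h1 : Even i
      · have : ¬ Even (n - i) := by
          rw [Nat.even_sub hi']; rw [Nat.even_add_one] at hn; tauto
        simp [he, this]
      · simp [he, h1, wt]
    · rw [if_neg hn]
      symm
      apply mul_eq_zero_of_right
      refine Finset.sum_eq_zero fun i hi => ?_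
      have hi' : i ≤ n := by simpa [Nat.lt_succ_iff] using hi
      by_cases h1 : Even i
      · simp [h1]
      · have : ¬ Even (n - i) := by
          rw [Nat.even_sub hi']; rw [Nat.even_add_one] at hn; tauto
        simp [this]
  have hW : egf e + PowerSeries.C X * egf jo = egf (wt j) := by
    rw [egf_smul, egf_add]; congr 1; funext n
    simp only [he, hjo, wt, Pi.add_apply]
    by_cases h : Even n
    · simp [h]
    · have : n ≠ 0 := by rintro rfl; simp at h
      simp [h, this]
  have key : PowerSeries.derivative ℚ[X] (PowerSeries.derivative ℚ[X] (egf j))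
      = egf (wt j) * PowerSeries.derivative ℚ[X] (egf j) := by
    conv_lhs => rw [hJ]
    rw [ps_leibniz, hE, hJ, ← hW]
    ring
  rw [egf_deriv, egf_deriv, egf_mul] at key
  intro n
  exact congrFun (egf_inj key) n

lemma bconv_congr {u v u' v' : ℕ → ℚ[X]} {n : ℕ} (hu : ∀ i ≤ n, u i = u' i)
    (hv : ∀ i ≤ n, v i = v' i) : bconv u v n = bconv u' v' n := by
  refine Finset.sum_congr rfl fun i hi => ?_
  have hi' : i ≤ n := by simpa [Nat.lt_succ_iff] using hi
  rw [hu i hi', hv (n - i) (Nat.sub_le _ _)]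

lemma seq_eq (j a : ℕ → ℚ[X]) (h0 : j 0 = 1)
    (hj : ∀ n, j (n + 1) = bconv j (fun m => if Even m then wt j m else 0) n)
    (a0 : a 0 = 1) (a1 : a 1 = 1)
    (ha : ∀ n, a (n + 2) = bconv (wt a) (fun m => a (m + 1)) n) : j = a := by
  have h2 := jacobi_second_order j hj
  funext n
  induction n using Nat.strong_induction_on with
  | _ n ih =>
    match n, ih with
    | 0, _ => rw [h0, a0]
    | 1, _ => rw [hj 0, a1]; simp [bconv, h0, wt]
    | n + 2, ih =>
      rw [h2, ha]
      refine bconv_congr (fun i hi => ?_) (fun i hi => ih _ (by omega))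
      unfold wt
      rw [ih i (by omega)]

end EGF
section Words

/-- Words with distinct letters whose set of letters is `S`. -/
def words (S : Finset ℕ) : Finset (List ℕ) := (Multiset.lists S.val).toFinset

lemma mem_words {S : Finset ℕ} {w : List ℕ} : w ∈ words S ↔ w.Nodup ∧ w.toFinset = S := by
  unfold words
  rw [Multiset.mem_toFinset, Multiset.mem_lists_iff]
  constructor
  · intro h
    have hn : w.Nodup := by
      have := S.nodup; rw [h] at this; simpa using this
    refine ⟨hn, ?_⟩
    ext x
    rw [List.mem_toFinset, ← Finset.mem_val, h]; simp
  · rintro ⟨hn, rfl⟩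
    rw [List.toFinset_val, hn.dedup]; rfl

lemma length_of_mem_words {S : Finset ℕ} {w : List ℕ} (h : w ∈ words S) : w.length = S.card := by
  rw [mem_words] at h
  rw [← h.2, List.toFinset_card_of_nodup h.1]

lemma mem_of_mem_words {S : Finset ℕ} {w : List ℕ} (h : w ∈ words S) {x : ℕ} :
    x ∈ w ↔ x ∈ S := by
  rw [mem_words] at h
  rw [← h.2, List.mem_toFinset]

lemma words_empty : words ∅ = {[]} := by
  ext w
  rw [mem_words, Finset.mem_singleton, List.toFinset_eq_empty_iff]
  constructor
  · exact fun h => h.2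
  · rintro rfl; simp

lemma sum_words_insert {M : Type*} [AddCommMonoid M] (S : Finset ℕ) (y : ℕ)
    (hy : y ∉ S) (f : List ℕ → M) :
    ∑ w ∈ words (insert y S), f w
      = ∑ T ∈ S.powerset, ∑ α ∈ words T, ∑ β ∈ words (S \ T), f (α ++ y :: β) := by
  simp_rw [← Finset.sum_product']
  rw [Finset.sum_sigma' S.powerset (fun T => words T ×ˢ words (S \ T))
    (fun _ p => f (p.1 ++ y :: p.2))]
  symm
  refine Finset.sum_bij (fun p _ => p.2.1 ++ y :: p.2.2) ?_ ?_ ?_ ?_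
  · rintro ⟨T, α, β⟩ h
    simp only [Finset.mem_sigma, Finset.mem_powerset, Finset.mem_product, mem_words] at h
    obtain ⟨hT, ⟨hα, rfl⟩, hβ, hβS⟩ := h
    have hb : ∀ x, x ∈ β ↔ x ∈ S ∧ x ∉ α := by
      intro x; rw [← List.mem_toFinset, hβS]; simp
    have ha : ∀ x, x ∈ α → x ∈ S := by
      intro x hx; exact hT (by simpa using hx)
    simp only [mem_words]
    constructor
    · rw [List.nodup_append, List.nodup_cons]
      refine ⟨hα, ⟨fun h => hy ((hb y).1 h).1, hβ⟩, ?_⟩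
      intro a haα b hb' hab
      subst hab
      rcases List.mem_cons.1 hb' with h | h
      · subst h; exact hy (ha _ haα)
      · exact ((hb _).1 h).2 haα
    · ext x
      simp only [List.mem_toFinset, List.mem_append, List.mem_cons, Finset.mem_insert, hb]
      have := ha x
      tauto
  · rintro ⟨T, α, β⟩ h ⟨T', α', β'⟩ h' heq
    simp only [Finset.mem_sigma, Finset.mem_powerset, Finset.mem_product] at h h' heq
    have h1 : y ∉ α := fun hh => hy (h.1 ((mem_of_mem_words h.2.1).1 hh))
    have h2 : y ∉ β := fun hh =>
      hy (Finset.mem_sdiff.1 ((mem_of_mem_words h.2.2).1 hh)).1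
    have h1' : y ∉ α' := fun hh => hy (h'.1 ((mem_of_mem_words h'.2.1).1 hh))
    have := (List.append_cons_inj_of_notMem h1 h2).1 heq
    obtain ⟨e1, -, e2⟩ := this
    subst e1 e2
    have e3 : T = T' := by
      rw [← (mem_words.1 h.2.1).2, ← (mem_words.1 h'.2.1).2]
    subst e3
    rfl
  · intro w hw
    have hyw : y ∈ w := (mem_of_mem_words hw).2 (Finset.mem_insert_self _ _)
    obtain ⟨α, β, rfl⟩ := List.append_of_mem hyw
    obtain ⟨hn, hs⟩ := mem_words.1 hw
    rw [List.nodup_append, List.nodup_cons] at hn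
    have hm : ∀ x, (x ∈ α ∨ x = y ∨ x ∈ β) ↔ (x = y ∨ x ∈ S) := by
      intro x
      have := congrArg (x ∈ ·) hs
      simp only [List.mem_toFinset, List.mem_append, List.mem_cons, Finset.mem_insert,
        eq_iff_iff] at this
      exact this
    have hya : y ∉ α := fun h => hn.2.2 y h y (by simp) rfl
    refine ⟨⟨α.toFinset, α, β⟩, ?_, rfl⟩
    simp only [Finset.mem_sigma, Finset.mem_powerset, Finset.mem_product, mem_words]
    refine ⟨?_, ⟨hn.1, trivial⟩, hn.2.1.2, ?_⟩
    · intro x hx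
      have hx' : x ∈ α := by simpa using hx
      rcases (hm x).1 (Or.inl hx') with rfl | h
      · exact absurd hx' hya
      · exact h
    · ext x
      simp only [List.mem_toFinset, Finset.mem_sdiff]
      constructor
      · intro hx
        refine ⟨?_, fun hxa => hn.2.2 x hxa x (by simp [hx]) rfl⟩
        rcases (hm x).1 (Or.inr (Or.inr hx)) with rfl | h
        · exact absurd hx hn.2.1.1
        · exact h
      · rintro ⟨hxS, hxa⟩
        rcases (hm x).2 (Or.inr hxS) with h | rfl | h
        · exact absurd h hxa
        · exact absurd hxS hy
        · exact h
  · intros; rfl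

/-- Number of adjacent pairs satisfying `r`. -/
def adj (r : ℕ → ℕ → Bool) : List ℕ → ℕ
  | [] => 0
  | [_] => 0
  | a :: b :: l => (if r a b then 1 else 0) + adj r (b :: l)

lemma adj_append (r : ℕ → ℕ → Bool) (α β : List ℕ) (y : ℕ) :
    adj r (α ++ y :: β) = adj r α + adj r β
      + (if h : α = [] then 0 else if r (α.getLast h) y then 1 else 0)
      + (if h : β = [] then 0 else if r y (β.head h) then 1 else 0) := by
  induction α with
  | nil =>
    cases β with
    | nil => simp [adj]
    | cons b l => grind [adj]
  | cons a l ih =>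
    cases l with
    | nil => cases β <;> grind [adj]
    | cons b l => grind [adj]

/-- Jacobi words. -/
def JacL : List ℕ → Prop
  | [] => True
  | a :: l => Even (l.takeWhile (fun x => decide (a < x))).length ∧ JacL l

lemma jacL_append (α β : List ℕ) (y : ℕ) (h : ∀ x ∈ α ++ β, y < x) :
    JacL (α ++ y :: β) ↔ JacL α ∧ Even β.length ∧ JacL β := by
  induction α with
  | nil =>
    simp only [List.nil_append, JacL, true_and]
    rw [List.takeWhile_eq_self_iff.2]
    intro x hx; simpa using h x (by simp [hx])
  | cons a l ih =>
    simp only [List.cons_append, JacL]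
    rw [ih (fun x hx => h x (by simp only [List.cons_append, List.mem_cons]; exact Or.inr hx))]
    have hya : y < a := h a (by simp)
    have : List.takeWhile (fun x => decide (a < x)) (l ++ y :: β)
        = List.takeWhile (fun x => decide (a < x)) l := by
      clear ih h
      induction l with
      | nil => simp [List.takeWhile_cons]; omega
      | cons b l ih => simp [List.takeWhile_cons, ih]
    rw [this, and_assoc]

lemma isAndre_append (α β : List ℕ) (y : ℕ) (h : ∀ x ∈ α ++ β, y < x) :
    IsAndre (α ++ y :: β) ↔
      IsAndre α ∧ IsAndre β ∧ (α ++ β = [] ∨ ∃ z ∈ β, ∀ x ∈ α ++ β, x ≤ z) := by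
  constructor
  · intro hA
    generalize hw : α ++ y :: β = w at hA
    cases hA with
    | nil => simp at hw
    | node α' β' y' hmin hα hβ hmax =>
      have e : y = y' := by
        have h1 : y ∈ α' ++ y' :: β' := by rw [← hw]; simp
        have h2 : y' ∈ α ++ y :: β := by rw [hw]; simp
        by_contra hne
        have h1' : y' < y := hmin y (by
          simp only [List.mem_append, List.mem_cons] at h1 ⊢; tauto)
        have h2' : y < y' := h y' (by
          simp only [List.mem_append, List.mem_cons] at h2 ⊢
          have : ¬ y' = y := fun h => hne h.symm
          tauto)
        omega
      subst e
      have h1 : y ∉ α := fun hh => lt_irrefl y (h y (by simp [hh]))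
      have h1' : y ∉ β := fun hh => lt_irrefl y (h y (by simp [hh]))
      obtain ⟨e1, -, e2⟩ := (List.append_cons_inj_of_notMem h1 h1').1 hw
      subst e1 e2
      exact ⟨hα, hβ, hmax⟩
  · rintro ⟨h1, h2, h3⟩
    exact IsAndre.node α β y h h1 h2 h3

end Words

section Weighted
open Polynomial
open scoped Classical in
/-- Weighted count of the words on `S` with property `P`. -/
noncomputable def wsum (P : List ℕ → Prop) (st : List ℕ → ℕ) (S : Finset ℕ) : ℚ[X] :=
  ∑ w ∈ words S, if P w then X ^ st w else 0

open scoped Classical in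
lemma wsum_coeff (P : List ℕ → Prop) (st : List ℕ → ℕ) (S : Finset ℕ) (k : ℕ) :
    (wsum P st S).coeff k = (((words S).filter fun w => P w ∧ st w = k).card : ℚ) := by
  unfold wsum
  rw [Polynomial.finsetSum_coeff, Finset.card_filter]
  push_cast
  refine Finset.sum_congr rfl fun w _ => ?_
  by_cases h : P w
  · simp [h, Polynomial.coeff_X_pow, eq_comm]
  · simp [h]

/-- ascents -/
def ascL : List ℕ → ℕ := adj fun a b => decide (a < b)
/-- descents -/
def desL : List ℕ → ℕ := adj fun a b => decide (b < a)

lemma ascL_append (α β : List ℕ) (y : ℕ) (h : ∀ x ∈ α ++ β, y < x) :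
    ascL (α ++ y :: β) = ascL α + ascL β + (if β.length = 0 then 0 else 1) := by
  unfold ascL
  rw [adj_append]
  have h1 : (if h : α = [] then 0 else
      if decide (α.getLast h < y) = true then 1 else 0) = 0 := by
    split_ifs with h1 h2
    · rfl
    · have := h (α.getLast h1) (by simp)
      simp at h2; omega
    · rfl
  rw [h1]
  cases β with
  | nil => simp
  | cons b l =>
    have := h b (by simp)
    simp [this]

lemma desL_append (α β : List ℕ) (y : ℕ) (h : ∀ x ∈ α ++ β, y < x) :
    desL (α ++ y :: β) = desL α + desL β + (if α.length = 0 then 0 else 1) := by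
  unfold desL
  rw [adj_append]
  have h1 : (if h : β = [] then 0 else
      if decide (β.head h < y) = true then 1 else 0) = 0 := by
    split_ifs with h1 h2
    · rfl
    · have := h (β.head h1) (by simp)
      simp at h2; omega
    · rfl
  rw [h1]
  by_cases ha : α = []
  · subst ha; simp
  · have := h (α.getLast ha) (by simp)
    simp [this, ha]

/-- Jacobi weighted count -/
noncomputable def FJ : Finset ℕ → ℚ[X] := wsum JacL ascL
/-- André weighted count -/
noncomputable def FA : Finset ℕ → ℚ[X] := wsum IsAndre desL

lemma FJ_empty : FJ ∅ = 1 := by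
  simp [FJ, wsum, words_empty, JacL, ascL, adj]

lemma FA_empty : FA ∅ = 1 := by
  simp [FA, wsum, words_empty, IsAndre.nil, desL, adj]

lemma mem_lt {S T : Finset ℕ} {y : ℕ} (hy : ∀ x ∈ S, y < x) (hT : T ⊆ S) {α β : List ℕ}
    (hα : α ∈ words T) (hβ : β ∈ words (S \ T)) : ∀ x ∈ α ++ β, y < x := by
  intro x hx
  rcases List.mem_append.1 hx with h | h
  · exact hy x (hT ((mem_of_mem_words hα).1 h))
  · exact hy x (Finset.mem_sdiff.1 ((mem_of_mem_words hβ).1 h)).1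

lemma FJ_insert (S : Finset ℕ) (y : ℕ) (hy : ∀ x ∈ S, y < x) :
    FJ (insert y S) = ∑ T ∈ S.powerset, FJ T *
      (if Even (S \ T).card then (if (S \ T).card = 0 then 1 else X * FJ (S \ T)) else 0) := by
  classical
  have hyS : y ∉ S := fun h => lt_irrefl y (hy y h)
  unfold FJ wsum
  rw [sum_words_insert S y hyS]
  refine Finset.sum_congr rfl fun T hT => ?_
  rw [Finset.mem_powerset] at hT
  have : (if Even (S \ T).card then (if (S \ T).card = 0 then 1 else
      X * ∑ w ∈ words (S \ T), if JacL w then (X : ℚ[X]) ^ ascL w else 0) else 0)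
      = ∑ w ∈ words (S \ T), if Even (S \ T).card then
        (if (S \ T).card = 0 then 1 else X) * (if JacL w then (X : ℚ[X]) ^ ascL w else 0)
        else 0 := by
    split_ifs with h1 h2
    · rw [Finset.card_eq_zero] at h2
      rw [h2, words_empty]; simp [JacL, ascL, adj]
    · rw [Finset.mul_sum]
    · simp
  rw [this, Finset.sum_mul_sum]
  refine Finset.sum_congr rfl fun α hα => Finset.sum_congr rfl fun β hβ => ?_
  have hlt := mem_lt hy hT hα hβ
  simp only [jacL_append _ _ _ hlt, ascL_append _ _ _ hlt, length_of_mem_words hβ]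
  by_cases c1 : JacL α <;> by_cases c2 : JacL β <;> by_cases c3 : Even (S \ T).card <;>
    by_cases c4 : (S \ T).card = 0 <;> simp [c1, c2, c3, c4, pow_add] <;> ring

lemma ite_sum_sum (Q : Prop) [Decidable Q] (s t : Finset (List ℕ))
    (f : List ℕ → List ℕ → ℚ[X]) : (if Q then ∑ a ∈ s, ∑ b ∈ t, f a b else 0)
      = ∑ a ∈ s, ∑ b ∈ t, if Q then f a b else 0 := by
  split_ifs <;> simp

lemma FA_insert (S : Finset ℕ) (y : ℕ) (hy : ∀ x ∈ S, y < x) :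
    FA (insert y S) = ∑ T ∈ S.powerset,
      if (S = ∅ ∨ ∃ z ∈ S \ T, ∀ x ∈ S, x ≤ z) then
        (if T.card = 0 then 1 else X * FA T) * FA (S \ T) else 0 := by
  classical
  have hyS : y ∉ S := fun h => lt_irrefl y (hy y h)
  unfold FA wsum
  rw [sum_words_insert S y hyS]
  refine Finset.sum_congr rfl fun T hT => ?_
  rw [Finset.mem_powerset] at hT
  have : (if T.card = 0 then 1 else
      X * ∑ w ∈ words T, if IsAndre w then (X : ℚ[X]) ^ desL w else 0)
      = ∑ w ∈ words T,
        (if T.card = 0 then 1 else X) * (if IsAndre w then (X : ℚ[X]) ^ desL w else 0) := by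
    split_ifs with h2
    · rw [Finset.card_eq_zero] at h2
      rw [h2, words_empty]; simp [IsAndre.nil, desL, adj]
    · rw [Finset.mul_sum]
  rw [this, Finset.sum_mul_sum]
  rw [ite_sum_sum]
  refine Finset.sum_congr rfl fun α hα => Finset.sum_congr rfl fun β hβ => ?_
  have hlt := mem_lt hy hT hα hβ
  have hm : ∀ x, x ∈ α ++ β ↔ x ∈ S := by
    intro x
    rw [List.mem_append, mem_of_mem_words hα, mem_of_mem_words hβ, Finset.mem_sdiff]
    have := @hT x
    tauto
  have hc : (α ++ β = [] ∨ ∃ z ∈ β, ∀ x ∈ α ++ β, x ≤ z) ↔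
      (S = ∅ ∨ ∃ z ∈ S \ T, ∀ x ∈ S, x ≤ z) := by
    simp only [hm, mem_of_mem_words hβ]
    rw [List.eq_nil_iff_forall_not_mem, Finset.eq_empty_iff_forall_notMem]
    simp only [hm]
  simp only [isAndre_append _ _ _ hlt, desL_append _ _ _ hlt, length_of_mem_words hα, hc]
  by_cases c3 : (S = ∅ ∨ ∃ z ∈ S \ T, ∀ x ∈ S, x ≤ z)
  · rw [if_pos c3]
    have e : (IsAndre α ∧ IsAndre β ∧ (S = ∅ ∨ ∃ z ∈ S \ T, ∀ x ∈ S, x ≤ z)) ↔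
        (IsAndre α ∧ IsAndre β) := by tauto
    simp only [e]
    clear e c3 hc
    by_cases c1 : IsAndre α <;> by_cases c2 : IsAndre β <;>
      by_cases c4 : T.card = 0 <;> simp [c1, c2, c4, pow_add] <;> ring
  · rw [if_neg c3, if_neg (fun h => c3 h.2.2)]

/-- Jacobi polynomials -/
noncomputable def jseq : ℕ → ℚ[X]
  | 0 => 1
  | n + 1 => ∑ i : Fin (n + 1), n.choose i • (jseq i *
      (if Even (n - i) then (if n - i = 0 then 1 else X * jseq (n - i)) else 0))
decreasing_by all_goals omega

/-- André polynomials -/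
noncomputable def aseq : ℕ → ℚ[X]
  | 0 => 1
  | 1 => 1
  | n + 2 => ∑ i : Fin (n + 1), n.choose i • ((if (i : ℕ) = 0 then 1 else X * aseq i) *
      aseq (n - i + 1))
decreasing_by all_goals omega

lemma jseq_succ (n : ℕ) :
    jseq (n + 1) = bconv jseq (fun m => if Even m then wt jseq m else 0) n := by
  rw [jseq, bconv, Finset.sum_range]
  rfl

lemma aseq_succ (n : ℕ) :
    aseq (n + 2) = bconv (wt aseq) (fun m => aseq (m + 1)) n := by
  rw [aseq, bconv, Finset.sum_range]
  rfl

lemma exists_min_insert (S : Finset ℕ) (n : ℕ) (h : S.card = n + 1) :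
    ∃ y S', S = insert y S' ∧ S'.card = n ∧ ∀ x ∈ S', y < x := by
  have hne : S.Nonempty := Finset.card_pos.1 (by omega)
  refine ⟨S.min' hne, S.erase (S.min' hne), ?_, ?_, ?_⟩
  · rw [Finset.insert_erase (S.min'_mem hne)]
  · rw [Finset.card_erase_of_mem (S.min'_mem hne)]; omega
  · intro x hx
    exact Finset.min'_lt_of_mem_erase_min' _ _ hx

lemma FJ_eq (n : ℕ) : ∀ S : Finset ℕ, S.card = n → FJ S = jseq n := by
  induction n using Nat.strong_induction_on with
  | _ n ih =>
    intro S hS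
    match n, ih, hS with
    | 0, _, hS =>
      rw [Finset.card_eq_zero] at hS
      rw [hS, FJ_empty, jseq]
    | n + 1, ih, hS =>
      obtain ⟨y, S', rfl, hc, hy⟩ := exists_min_insert S n hS
      rw [FJ_insert S' y hy, jseq_succ, bconv, ← hc,
        ← Finset.sum_powerset_apply_card (fun i => jseq i *
          (if Even (S'.card - i) then wt jseq (S'.card - i) else 0))]
      refine Finset.sum_congr rfl fun T hT => ?_
      rw [Finset.mem_powerset] at hT
      have hle := Finset.card_le_card hT
      have hd := Finset.card_sdiff_of_subset hT
      rw [ih T.card (by omega) T rfl, ih (S' \ T).card (by omega) _ rfl, hd]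
      rfl

lemma FA_eq (n : ℕ) : ∀ S : Finset ℕ, S.card = n → FA S = aseq n := by
  induction n using Nat.strong_induction_on with
  | _ n ih =>
    intro S hS
    match n, ih, hS with
    | 0, _, hS =>
      rw [Finset.card_eq_zero] at hS
      rw [hS, FA_empty, aseq]
    | 1, _, hS =>
      obtain ⟨y, S', rfl, hc, hy⟩ := exists_min_insert S 0 hS
      rw [Finset.card_eq_zero] at hc
      subst hc
      rw [FA_insert _ y hy, aseq]
      simp [FA_empty]
    | n + 2, ih, hS =>
      obtain ⟨y, S', rfl, hc, hy⟩ := exists_min_insert S (n + 1) hS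
      have hne : S'.Nonempty := Finset.card_pos.1 (by omega)
      have hz := S'.max'_mem hne
      have hzle : ∀ x ∈ S', x ≤ S'.max' hne := fun x hx => S'.le_max' x hx
      generalize S'.max' hne = z at hz hzle
      have hc' : (S'.erase z).card = n := by
        rw [Finset.card_erase_of_mem hz]; omega
      rw [FA_insert S' y hy, aseq_succ, bconv, ← hc',
        ← Finset.sum_powerset_apply_card (fun i => wt aseq i * aseq ((S'.erase z).card - i + 1)),
        hc']
      symm
      refine Finset.sum_subset_zero_on_sdiff
        (Finset.powerset_mono.2 (Finset.erase_subset _ _)) ?_ ?_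
      · intro T hT
        rw [Finset.mem_sdiff, Finset.mem_powerset, Finset.mem_powerset,
          Finset.subset_erase] at hT
        have hzT : z ∈ T := by tauto
        rw [if_neg]
        rintro (h | ⟨x, hx, hx'⟩)
        · exact hne.ne_empty h
        · have : x = z := le_antisymm (hzle x (Finset.mem_sdiff.1 hx).1) (hx' z hz)
          subst this
          exact (Finset.mem_sdiff.1 hx).2 hzT
      · intro T hT
        rw [Finset.mem_powerset] at hT
        have hle := Finset.card_le_card hT
        rw [Finset.subset_erase] at hT
        have hd := Finset.card_sdiff_of_subset hT.1
        rw [if_pos (Or.inr ⟨z, Finset.mem_sdiff.2 ⟨hz, hT.2⟩, hzle⟩)]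
        rw [ih T.card (by omega) T rfl, ih (S' \ T).card (by omega) _ rfl, hd]
        rw [show S'.card - T.card = n - T.card + 1 by omega]
        rfl

lemma FJ_eq_FA (S : Finset ℕ) : FJ S = FA S := by
  rw [FJ_eq _ S rfl, FA_eq _ S rfl]
  exact congrFun (seq_eq jseq aseq (by rw [jseq]) jseq_succ (by rw [aseq]) (by rw [aseq])
    aseq_succ) _

open scoped Classical in
lemma card_words_eq (S : Finset ℕ) (k : ℕ) :
    ((words S).filter fun w => JacL w ∧ ascL w = k).card =
    ((words S).filter fun w => IsAndre w ∧ desL w = k).card := by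
  have h := congrArg (fun p => p.coeff k) (FJ_eq_FA S)
  simp only [FJ, FA, wsum_coeff] at h
  exact_mod_cast h

end Weighted

section Link

lemma toWord_injective {n : ℕ} : Function.Injective (toWord (n := n)) := by
  intro π σ h
  have := List.ofFn_injective h
  ext i
  have h2 : (π i : ℕ) + 1 = (σ i : ℕ) + 1 := congrFun this i
  omega

lemma toWord_mem {n : ℕ} (π : Equiv.Perm (Fin n)) : toWord π ∈ words (Finset.Icc 1 n) := by
  rw [mem_words]
  constructor
  · rw [toWord, List.nodup_ofFn]
    intro i j h
    simp only at h
    exact π.injective (Fin.ext (by omega))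
  · ext x
    simp only [toWord, List.mem_toFinset, List.mem_ofFn, Finset.mem_Icc]
    constructor
    · rintro ⟨i, rfl⟩
      have := (π i).isLt
      omega
    · rintro ⟨h1, h2⟩
      refine ⟨π.symm ⟨x - 1, by omega⟩, ?_⟩
      simp; omega

lemma exists_toWord {n : ℕ} {w : List ℕ} (hw : w ∈ words (Finset.Icc 1 n)) :
    ∃ π : Equiv.Perm (Fin n), toWord π = w := by
  have hl : w.length = n := by rw [length_of_mem_words hw]; simp
  have hm : ∀ x, x ∈ w ↔ 1 ≤ x ∧ x ≤ n := by
    intro x; rw [mem_of_mem_words hw, Finset.mem_Icc]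
  have hn := (mem_words.1 hw).1
  let f : Fin n → Fin n := fun i =>
    ⟨w[(i : ℕ)]'(by omega) - 1, by
      have := (hm _).1 (List.getElem_mem (l := w) (n := i) (by omega))
      omega⟩
  have hf : Function.Injective f := by
    intro i j h
    have h' : w[(i : ℕ)]'(by omega) - 1 = w[(j : ℕ)]'(by omega) - 1 := congrArg Fin.val h
    have h1 := (hm _).1 (List.getElem_mem (l := w) (n := i) (by omega))
    have h2 := (hm _).1 (List.getElem_mem (l := w) (n := j) (by omega))
    have : w[(i : ℕ)]'(by omega) = w[(j : ℕ)]'(by omega) := by omega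
    exact Fin.ext ((hn.getElem_inj_iff).1 this)
  refine ⟨Equiv.ofBijective f (Finite.injective_iff_bijective.1 hf), ?_⟩
  apply List.ext_getElem
  · simp [toWord, hl]
  · intro i h1 h2
    have := (hm _).1 (List.getElem_mem (l := w) (n := i) h2)
    simp [toWord, f]; omega

open scoped Classical in
lemma card_perm_eq (n : ℕ) (P : List ℕ → Prop) :
    Nat.card {π : Equiv.Perm (Fin n) // P (toWord π)} =
      ((words (Finset.Icc 1 n)).filter P).card := by
  rw [Nat.card_eq_fintype_card, Fintype.card_subtype]
  refine Finset.card_bij (fun π _ => toWord π) ?_ ?_ ?_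
  · intro π h
    rw [Finset.mem_filter] at h ⊢
    exact ⟨toWord_mem π, h.2⟩
  · intro π _ σ _ h
    exact toWord_injective h
  · intro w hw
    rw [Finset.mem_filter] at hw
    obtain ⟨π, rfl⟩ := exists_toWord hw.1
    exact ⟨π, by simpa using hw.2, rfl⟩

open scoped Classical in
lemma natCard_sum {n : ℕ} (P : Fin n → Prop) :
    Nat.card {k : Fin n // P k} = ∑ k : Fin n, if P k then 1 else 0 := by
  rw [Nat.card_eq_fintype_card, Fintype.card_subtype, Finset.card_filter]

lemma adj_ofFn (r : ℕ → ℕ → Bool) {n : ℕ} (f : Fin n → ℕ) :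
    adj r (List.ofFn f) =
      Nat.card {k : Fin n // ∃ h : (k : ℕ) + 1 < n, r (f k) (f ⟨(k : ℕ) + 1, h⟩)} := by
  classical
  rw [natCard_sum]
  induction n with
  | zero => simp [adj]
  | succ n ih =>
    cases n with
    | zero =>
      rw [Finset.sum_eq_zero]
      · simp [adj]
      · intro k _
        rw [if_neg]
        rintro ⟨h, -⟩
        omega
    | succ n =>
      have := ih (fun i => f i.succ)
      have e : adj r (List.ofFn f) = (if r (f 0) (f 1) then 1 else 0)
          + adj r (List.ofFn fun i => f i.succ) := by
        rw [List.ofFn_succ, List.ofFn_succ, adj]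
        rfl
      rw [Fin.sum_univ_succ, e, this]
      congr 1
      · simp
      · refine Finset.sum_congr rfl fun k _ => ?_
        simp [Fin.succ]

lemma takeWhile_ofFn (c : ℕ) {n : ℕ} (g : Fin n → ℕ) :
    ((List.ofFn g).takeWhile (fun x => decide (c < x))).length =
      Nat.card {j : Fin n // ∀ i ≤ j, c < g i} := by
  classical
  rw [natCard_sum]
  induction n with
  | zero => simp
  | succ n ih =>
    have := ih (fun i => g i.succ)
    rw [Fin.sum_univ_succ, List.ofFn_succ, List.takeWhile_cons]
    simp only [Fin.forall_fin_succ, Fin.succ_le_succ_iff, Fin.zero_le, true_imp_iff]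
    by_cases h : c < g 0
    · simp [h, this, add_comm, -Finset.sum_boole]
      congr!
    · simp [h]

lemma jacL_ofFn {n : ℕ} (f : Fin n → ℕ) :
    JacL (List.ofFn f) ↔ ∀ k : Fin n,
      Even (Nat.card {j : Fin n // k < j ∧ ∀ i : Fin n, k < i → i ≤ j → f k < f i}) := by
  classical
  induction n with
  | zero => simp [JacL]
  | succ n ih =>
    rw [List.ofFn_succ, JacL, ih, Fin.forall_fin_succ, takeWhile_ofFn]
    simp only [natCard_sum]
    simp [Fin.sum_univ_succ, Fin.forall_fin_succ, -Finset.sum_boole]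
    congr!

lemma isJacobi_iff {n : ℕ} (π : Equiv.Perm (Fin n)) : IsJacobi π ↔ JacL (toWord π) := by
  rw [toWord, jacL_ofFn]
  simp [IsJacobi, rhoLen]

lemma ascCount_eq {n : ℕ} (π : Equiv.Perm (Fin n)) : ascCount π = ascL (toWord π) := by
  rw [toWord, ascL, adj_ofFn]
  simp [ascCount]

lemma descCount_eq {n : ℕ} (π : Equiv.Perm (Fin n)) : descCount π = desL (toWord π) := by
  rw [toWord, desL, adj_ofFn]
  simp [descCount]

end Link

/-- The number of Jacobi permutations of `[n]` with exactly `k` ascents equals the number of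
André permutations of `[n]` with exactly `k` descents. -/
theorem jacobi_asc_eq_andre_des (n k : ℕ) :
    Nat.card {π : Equiv.Perm (Fin n) // IsJacobi π ∧ ascCount π = k} =
      Nat.card {π : Equiv.Perm (Fin n) // IsAndre (toWord π) ∧ descCount π = k} := by

  simp only [isJacobi_iff, ascCount_eq, descCount_eq]
  rw [card_perm_eq n (fun w => JacL w ∧ ascL w = k),
    card_perm_eq n (fun w => IsAndre w ∧ desL w = k)]
  convert card_words_eq _ _
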